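/- Let [a,b] ⊂ ℝ be compact, f₀ a probability density on [a,b] with f₀ > 0 and TV(log f₀) < ∞, and let x₁,...,xₙ be i.i.d. with density f₀. Let F be the class of probability densities f on [a,b] with f > 0 and TV(log f) < ∞, and for f ∈ F set p_f = (1/2) log((f + f₀)/(2f₀)) and J(f) = 1 + TV(log f) + TV(log f₀). Then there exist constants c₀, n₀, t₀ such that for all n ≥ n₀ and all T ≥ t₀, the outer probability that sup over {f ∈ F : h(f, f₀) ≤ n^{−1/3} J(f)} of n^{2/3} |(P_n − P)(p_f)| / J(f) is at least T is at most c₀·exp(−T/c₀²), where P_n(g) = (1/n)Σᵢ g(xᵢ) and P(g) = ∫ g f₀ dx. -/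

import Mathlib

open MeasureTheory Set

/-- membership in the class `F` of probability densities on `[a,b]` that are
positive with log of bounded variation. -/
def InF (a b : ℝ) (f : ℝ → ℝ) : Prop :=
  (∀ t ∈ Set.Icc a b, 0 < f t) ∧
    MeasureTheory.IntegrableOn f (Set.Icc a b) ∧
    (∫ t in Set.Icc a b, f t) = 1 ∧
    eVariationOn (fun t => Real.log (f t)) (Set.Icc a b) ≠ ⊤

/-- `J(f) = 1 + TV(log f) + TV(log f₀)` on `[a,b]`. -/
noncomputable def Jfun (a b : ℝ) (f₀ f : ℝ → ℝ) : ℝ :=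
  1 + (eVariationOn (fun t => Real.log (f t)) (Set.Icc a b)).toReal
    + (eVariationOn (fun t => Real.log (f₀ t)) (Set.Icc a b)).toReal

/-- Hellinger distance `h(f,g) = ((1/2)∫ₐᵇ(√f-√g)²)^{1/2}`. -/
noncomputable def hell (a b : ℝ) (f g : ℝ → ℝ) : ℝ :=
  Real.sqrt ((1 / 2) * ∫ t in Set.Icc a b, (Real.sqrt (f t) - Real.sqrt (g t)) ^ 2)

/-- `p_f = (1/2) log((f + f₀)/(2 f₀))`. -/
noncomputable def pfun (f₀ f : ℝ → ℝ) : ℝ → ℝ :=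
  fun t => (1 / 2) * Real.log ((f t + f₀ t) / (2 * f₀ t))

/-- the centered empirical process `(Pₙ - P)(g)` from the first `n` points of
the sample `X`, where `P(g) = ∫ₐᵇ g f₀`. -/
noncomputable def empProc {Ω : Type*} (a b : ℝ) (f₀ : ℝ → ℝ) (n : ℕ)
    (X : ℕ → Ω → ℝ) (g : ℝ → ℝ) (ω : Ω) : ℝ :=
  (1 / (n : ℝ)) * ∑ i ∈ Finset.range n, g (X i ω)
    - ∫ t in Set.Icc a b, g t * f₀ t

theorem sum_range_two_mul_div_two (F : ℕ → ℝ) (M : ℕ) :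
    ∑ j ∈ Finset.range (2 * M), F (j / 2) = 2 * ∑ j ∈ Finset.range M, F j := by
  induction M with
  | zero => simp
  | succ M ih =>
    rw [show 2 * (M + 1) = 2 * M + 1 + 1 by ring, Finset.sum_range_succ, Finset.sum_range_succ, ih,
      Finset.sum_range_succ]
    have h1 : (2 * M) / 2 = M := by omega
    have h2 : (2 * M + 1) / 2 = M := by omega
    rw [h1, h2]; ring

theorem sum_succ_mul_four_fifths_pow_le (N : ℕ) :
    ∑ k ∈ Finset.range N, ((k : ℝ) + 1) * (4 / 5) ^ k ≤ 25 := by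
  have h : ∑ k ∈ Finset.range N, ((k : ℝ) + 1) * (4 / 5) ^ k
      = 25 - (5 * N + 25) * (4 / 5) ^ N := by
    induction N with
    | zero => norm_num
    | succ N ih => rw [Finset.sum_range_succ, ih]; push_cast; ring
  rw [h]
  have : (0 : ℝ) ≤ (5 * N + 25) * (4 / 5) ^ N := by positivity
  linarith

/-- Entropy-type duality: a weight that is spread out, as measured by its `ℓ²` norm, can only put
little mass on the few indices at which `y` is large. -/
theorem sum_mul_le_of_sum_exp_le {ι : Type*} (S : Finset ι) (d y : ι → ℝ) {D B E L : ℝ}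
    (hd : ∀ j ∈ S, 0 ≤ d j) (hD : ∑ j ∈ S, d j ≤ D) (hB : 0 < B)
    (hB2 : ∑ j ∈ S, d j ^ 2 ≤ B) (hE : ∑ j ∈ S, Real.exp (y j) ≤ E) (hL : 0 ≤ L)
    (hBE : B * E ≤ Real.exp L) :
    ∑ j ∈ S, d j * y j ≤ D * L + 3 / 2 := by
  have key : ∀ j ∈ S, d j * y j ≤
      d j * L + (1 / (2 * B)) * d j ^ 2 + B * (Real.exp (-L) * Real.exp (y j)) := by
    intro j hj
    rw [← Real.exp_add]
    rcases le_total (y j) L with h | h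
    · have h1 := mul_le_mul_of_nonneg_left h (hd j hj)
      have h2 : 0 ≤ (1 / (2 * B)) * d j ^ 2 + B * Real.exp (-L + y j) := by positivity
      linarith
    · set z := y j - L with hz
      have hz0 : 0 ≤ z := by linarith
      have h1 : z ^ 2 / 2 ≤ Real.exp (-L + y j) := by
        have := Real.quadratic_le_exp_of_nonneg hz0
        rw [show -L + y j = z by rw [hz]; ring]
        linarith
      have h2 : d j * z ≤ (1 / (2 * B)) * d j ^ 2 + B * (z ^ 2 / 2) := by
        have : (1 / (2 * B)) * d j ^ 2 + B * (z ^ 2 / 2) - d j * z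
            = (1 / (2 * B)) * (d j - B * z) ^ 2 := by field_simp; ring
        have : 0 ≤ (1 / (2 * B)) * (d j - B * z) ^ 2 := by positivity
        linarith
      have h3 := mul_le_mul_of_nonneg_left h1 hB.le
      have h4 : d j * y j = d j * L + d j * z := by rw [hz]; ring
      linarith
  refine (Finset.sum_le_sum key).trans ?_
  rw [Finset.sum_add_distrib, Finset.sum_add_distrib, ← Finset.sum_mul, ← Finset.mul_sum,
    ← Finset.mul_sum, ← Finset.mul_sum]
  have h1 := mul_le_mul_of_nonneg_right hD hL
  have h2 : (1 / (2 * B)) * ∑ j ∈ S, d j ^ 2 ≤ 1 / 2 := by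
    calc _ ≤ (1 / (2 * B)) * B := by gcongr
      _ = 1 / 2 := by field_simp
  have h3 : B * (Real.exp (-L) * ∑ j ∈ S, Real.exp (y j)) ≤ 1 := by
    calc _ ≤ B * (Real.exp (-L) * E) := by gcongr
      _ = (B * E) * Real.exp (-L) := by ring
      _ ≤ Real.exp L * Real.exp (-L) := by gcongr
      _ = 1 := by rw [← Real.exp_add]; simp
  linarith

/-- The index of the cell containing `x` in the partition of `[a, b)` into `2 ^ l` cells of equal
length. -/
noncomputable def cellIndex (a b : ℝ) (l : ℕ) (x : ℝ) : ℕ := ⌊2 ^ l * ((x - a) / (b - a))⌋₊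

/-- The left endpoint of the `j`-th cell at level `l`. -/
noncomputable def cellEnd (a b : ℝ) (l j : ℕ) : ℝ := a + (b - a) * (j / 2 ^ l)

/-- The number of the first `n` points of `x` in the `j`-th cell at level `l`, centered by its
expectation under `μ`. -/
noncomputable def cellDev (a b : ℝ) (μ : Measure ℝ) (n : ℕ) (x : ℕ → ℝ) (l j : ℕ) : ℝ :=
  ∑ i ∈ Finset.range n,
    (({y | cellIndex a b l y = j}.indicator 1 (x i) : ℝ) - μ.real {y | cellIndex a b l y = j})

section Cells

variable {a b : ℝ}

theorem cellIndex_succ_div_two (l : ℕ) (x : ℝ) :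
    cellIndex a b (l + 1) x / 2 = cellIndex a b l x := by
  unfold cellIndex
  rw [← Nat.floor_div_natCast]
  congr 1
  push_cast
  ring

theorem measurable_cellIndex (l : ℕ) : Measurable (cellIndex a b l) := by
  unfold cellIndex
  fun_prop

theorem cellIndex_lt (hab : a < b) (l : ℕ) {x : ℝ} (hx : x ∈ Ico a b) :
    cellIndex a b l x < 2 ^ l := by
  have h : 0 < b - a := sub_pos.2 hab
  unfold cellIndex
  rw [Nat.floor_lt (by have := sub_nonneg.2 hx.1; positivity)]
  push_cast
  have : (x - a) / (b - a) < 1 := by rw [div_lt_one h]; linarith [hx.2]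
  have h2 : (0 : ℝ) < 2 ^ l := by positivity
  nlinarith

theorem mem_cell (hab : a < b) (l : ℕ) {x : ℝ} (hx : a ≤ x) :
    x ∈ Icc (cellEnd a b l (cellIndex a b l x)) (cellEnd a b l (cellIndex a b l x + 1)) := by
  have h : 0 < b - a := sub_pos.2 hab
  have h2 : (0 : ℝ) < 2 ^ l := by positivity
  have h0 : 0 ≤ 2 ^ l * ((x - a) / (b - a)) := by have := sub_nonneg.2 hx; positivity
  have hx' : x = a + (b - a) * ((2 ^ l * ((x - a) / (b - a))) / 2 ^ l) := by field_simp; ring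
  unfold cellEnd cellIndex
  set t := 2 ^ l * ((x - a) / (b - a))
  rw [hx']
  constructor
  · have := Nat.floor_le h0
    gcongr
  · have := (Nat.lt_floor_add_one t).le
    push_cast
    gcongr

theorem cellEnd_mono (hab : a < b) (l : ℕ) : Monotone (cellEnd a b l) := by
  intro i j hij
  have h : 0 ≤ b - a := (sub_pos.2 hab).le
  unfold cellEnd
  gcongr

theorem cellEnd_zero (l : ℕ) : cellEnd a b l 0 = a := by simp [cellEnd]

theorem cellEnd_two_pow (l : ℕ) : cellEnd a b l (2 ^ l) = b := by simp [cellEnd]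

theorem cellEnd_mem (hab : a < b) {l j : ℕ} (hj : j ≤ 2 ^ l) : cellEnd a b l j ∈ Icc a b := by
  constructor
  · exact (cellEnd_zero l).symm.le.trans (cellEnd_mono hab l (Nat.zero_le j))
  · exact (cellEnd_mono hab l hj).trans (cellEnd_two_pow l).le

theorem cellEnd_succ_sub (l j : ℕ) :
    cellEnd a b l (j + 1) - cellEnd a b l j = (b - a) / 2 ^ l := by
  unfold cellEnd; push_cast; ring

theorem cell_subset_parent (hab : a < b) (l j : ℕ) :
    Icc (cellEnd a b (l + 1) j) (cellEnd a b (l + 1) (j + 1)) ⊆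
      Icc (cellEnd a b l (j / 2)) (cellEnd a b l (j / 2 + 1)) := by
  have h : ∀ i, cellEnd a b l i = cellEnd a b (l + 1) (2 * i) := by
    intro i; unfold cellEnd; push_cast; field_simp; ring
  rw [h, h]
  exact Icc_subset_Icc (cellEnd_mono hab _ (by omega)) (cellEnd_mono hab _ (by omega))

theorem sum_comp_cellIndex_sub_integral (hab : a < b) {μ : Measure ℝ} [IsProbabilityMeasure μ]
    (hμ : ∀ᵐ y ∂μ, y ∈ Ico a b) {n : ℕ} {x : ℕ → ℝ} (hx : ∀ i < n, x i ∈ Ico a b) (l : ℕ)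
    (c : ℕ → ℝ) :
    Integrable (fun y => c (cellIndex a b l y)) μ ∧
    (∫ y, c (cellIndex a b l y) ∂μ
      = ∑ j ∈ Finset.range (2 ^ l), c j * μ.real {y | cellIndex a b l y = j}) ∧
    ∑ i ∈ Finset.range n, c (cellIndex a b l (x i)) - n * ∫ y, c (cellIndex a b l y) ∂μ
      = ∑ j ∈ Finset.range (2 ^ l), c j * cellDev a b μ n x l j := by
  have hmeas : ∀ j, MeasurableSet {y | cellIndex a b l y = j} := fun j =>
    measurable_cellIndex l (measurableSet_singleton j)
  have hexp : ∀ y ∈ Ico a b, c (cellIndex a b l y)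
      = ∑ j ∈ Finset.range (2 ^ l), c j * {z | cellIndex a b l z = j}.indicator 1 y := by
    intro y hy
    rw [Finset.sum_eq_single (cellIndex a b l y)]
    · simp
    · intro j _ hj
      simp [Set.indicator, hj.symm]
    · intro h; exact absurd (Finset.mem_range.2 (cellIndex_lt hab l hy)) h
  have hae : (fun y => c (cellIndex a b l y)) =ᵐ[μ] fun y =>
      ∑ j ∈ Finset.range (2 ^ l), c j * {z | cellIndex a b l z = j}.indicator 1 y := by
    filter_upwards [hμ] with y hy using hexp y hy
  have hI : ∀ j, Integrable ({z | cellIndex a b l z = j}.indicator (1 : ℝ → ℝ)) μ := fun j =>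
    (integrable_const (1 : ℝ)).indicator (hmeas j)
  have hint : ∫ y, c (cellIndex a b l y) ∂μ
      = ∑ j ∈ Finset.range (2 ^ l), c j * μ.real {y | cellIndex a b l y = j} := by
    rw [integral_congr_ae hae, integral_finsetSum _ fun j _ => (hI j).const_mul _]
    refine Finset.sum_congr rfl fun j _ => ?_
    rw [integral_const_mul, integral_indicator_one (hmeas j)]
  refine ⟨(integrable_congr hae).2 (integrable_finsetSum _ fun j _ => (hI j).const_mul _),
    hint, ?_⟩
  rw [hint, Finset.sum_congr rfl fun i hi => hexp (x i) (hx i (Finset.mem_range.1 hi)),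
    Finset.sum_comm, Finset.mul_sum, ← Finset.sum_sub_distrib]
  refine Finset.sum_congr rfl fun j _ => ?_
  unfold cellDev
  rw [Finset.sum_sub_distrib, Finset.sum_const, Finset.card_range, nsmul_eq_mul, mul_sub,
    Finset.mul_sum]
  ring

theorem exists_cell_points (hab : a < b) {g : ℝ → ℝ}
    (hg : IntegrableOn (fun t => g t ^ 2) (Icc a b)) (l : ℕ) :
    ∃ y : ℕ → ℝ, (∀ j < 2 ^ l, y j ∈ Icc (cellEnd a b l j) (cellEnd a b l (j + 1))) ∧
      (b - a) / 2 ^ l * ∑ j ∈ Finset.range (2 ^ l), g (y j) ^ 2 ≤ ∫ t in Icc a b, g t ^ 2 := by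
  have hw : 0 < (b - a) / 2 ^ l := by have := sub_pos.2 hab; positivity
  have hle : ∀ j, cellEnd a b l j ≤ cellEnd a b l (j + 1) := fun j =>
    cellEnd_mono hab l (Nat.le_succ j)
  have hsub : ∀ j < 2 ^ l, Ioc (cellEnd a b l j) (cellEnd a b l (j + 1)) ⊆ Icc a b := fun j hj =>
    Ioc_subset_Icc_self.trans (Icc_subset_Icc (cellEnd_mem hab hj.le).1 (cellEnd_mem hab hj).2)
  have hex : ∀ j, ∃ y, j < 2 ^ l → y ∈ Icc (cellEnd a b l j) (cellEnd a b l (j + 1)) ∧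
      (b - a) / 2 ^ l * g y ^ 2 ≤ ∫ t in cellEnd a b l j..cellEnd a b l (j + 1), g t ^ 2 := by
    intro j
    by_cases hj : j < 2 ^ l
    · have hvol : volume (Ioc (cellEnd a b l j) (cellEnd a b l (j + 1)))
          = ENNReal.ofReal ((b - a) / 2 ^ l) := by
        rw [Real.volume_Ioc, cellEnd_succ_sub]
      obtain ⟨y, hy, hle'⟩ := exists_le_setAverage (μ := volume)
        (s := Ioc (cellEnd a b l j) (cellEnd a b l (j + 1))) (f := fun t => g t ^ 2)
        (by rw [hvol]; simpa using hw) (by rw [hvol]; exact ENNReal.ofReal_ne_top)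
        (hg.mono_set (hsub j hj))
      refine ⟨y, fun _ => ⟨Ioc_subset_Icc_self hy, ?_⟩⟩
      rw [setAverage_eq, measureReal_def, hvol, ENNReal.toReal_ofReal hw.le, smul_eq_mul] at hle'
      rw [intervalIntegral.integral_of_le (hle j)]
      exact (le_inv_mul_iff₀ hw).1 hle'
    · exact ⟨0, fun h => absurd h hj⟩
  choose y hy using hex
  refine ⟨y, fun j hj => (hy j hj).1, ?_⟩
  rw [Finset.mul_sum]
  refine (Finset.sum_le_sum fun j hj => (hy j (Finset.mem_range.1 hj)).2).trans_eq ?_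
  rw [intervalIntegral.sum_integral_adjacent_intervals, cellEnd_zero, cellEnd_two_pow,
    intervalIntegral.integral_of_le hab.le, integral_Icc_eq_integral_Ioc]
  intro j hj
  rw [intervalIntegrable_iff_integrableOn_Ioc_of_le (hle j)]
  exact hg.mono_set (hsub j hj)

/-- The scale at which the centered count of a cell `k` levels below the coarsest level `K` has
bounded exponential moments. Any base in `(1, √2]` would do in place of `5 / 4`. -/
noncomputable def cellScale (K k : ℕ) : ℝ := (5 / 4) ^ k / 2 ^ K

theorem cellScale_pos (K k : ℕ) : 0 < cellScale K k := by unfold cellScale; positivity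

theorem inv_cellScale (K k : ℕ) : (cellScale K k)⁻¹ = 2 ^ K * (4 / 5) ^ k := by
  unfold cellScale
  rw [inv_div, div_eq_mul_inv, ← inv_pow]
  norm_num

theorem abs_sum_mul_le_of_sum_exp_le (M : ℕ) (c W : ℕ → ℝ) {θ D B E L : ℝ} (hθ : 0 < θ)
    (hD : ∑ j ∈ Finset.range M, |c j| ≤ D) (hB : 0 < B)
    (hB2 : ∑ j ∈ Finset.range M, c j ^ 2 ≤ B)
    (hE : ∑ j ∈ Finset.range M, Real.exp (θ * |W j|) ≤ E) (hL : 0 ≤ L)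
    (hBE : B * E ≤ Real.exp L) :
    |∑ j ∈ Finset.range M, c j * W j| ≤ θ⁻¹ * (D * L + 3 / 2) := by
  have h := sum_mul_le_of_sum_exp_le (Finset.range M) (fun j => |c j|) (fun j => θ * |W j|)
    (fun j _ => abs_nonneg _) hD hB (by simpa only [sq_abs] using hB2) hE hL hBE
  calc |∑ j ∈ Finset.range M, c j * W j| ≤ ∑ j ∈ Finset.range M, |c j * W j| :=
        Finset.abs_sum_le_sum_abs _ _
    _ = θ⁻¹ * ∑ j ∈ Finset.range M, |c j| * (θ * |W j|) := by
        rw [Finset.mul_sum]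
        refine Finset.sum_congr rfl fun j _ => ?_
        rw [abs_mul]; field_simp
    _ ≤ _ := by gcongr

theorem eight_pow_le_exp (k : ℕ) : (8 : ℝ) ^ k ≤ Real.exp (3 * k) := by
  have : (8 : ℝ) ≤ Real.exp 3 := by
    have h := Real.add_one_le_exp (1 : ℝ)
    calc (8 : ℝ) = (1 + 1) ^ 3 := by norm_num
      _ ≤ Real.exp 1 ^ 3 := by gcongr
      _ = Real.exp 3 := by rw [← Real.exp_nat_mul]; norm_num
  calc (8 : ℝ) ^ k ≤ Real.exp 3 ^ k := by gcongr
    _ = _ := by rw [← Real.exp_nat_mul]; ring_nf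

/-- The chaining bound: if all centered cell counts between the levels `K` and `2 * K` are under
control, then so is the empirical process at every function of total variation at most one (as
witnessed by the monotone function `V`) and small `L²` norm. -/
theorem abs_sum_sub_integral_le (hab : a < b) {μ : Measure ℝ} [IsProbabilityMeasure μ]
    (hμ : ∀ᵐ y ∂μ, y ∈ Ico a b) {Q : ℝ}
    (hQ : ∀ l, ∀ j < 2 ^ l, μ.real {y | cellIndex a b l y = j} ≤ Q / 2 ^ l)
    {n K : ℕ} (hn : n ≤ 8 ^ K) {x : ℕ → ℝ} (hx : ∀ i < n, x i ∈ Ico a b)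
    {H τ : ℝ} (hH : 1 ≤ H) (hτ : 0 ≤ τ)
    (hE : ∀ k ≤ K, ∑ j ∈ Finset.range (2 ^ (K + k)),
      Real.exp (cellScale K k * |cellDev a b μ n x (K + k) j|)
        ≤ 2 ^ (K + k) * 2 ^ k * Real.exp τ)
    {g V : ℝ → ℝ} (hg : Integrable g μ) (hg2 : IntegrableOn (fun t => g t ^ 2) (Icc a b))
    (hgH : ∫ t in Icc a b, g t ^ 2 ≤ (b - a) * H / 4 ^ K)
    (hV : MonotoneOn V (Icc a b)) (hV1 : V b - V a ≤ 1)
    (hgV : ∀ s ∈ Icc a b, ∀ t ∈ Icc a b, s ≤ t → |g t - g s| ≤ V t - V s) :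
    |∑ i ∈ Finset.range n, g (x i) - n * ∫ y, g y ∂μ|
      ≤ (100 * H * (4 * H + 5 + τ) + 2 * Q) * 2 ^ K := by
  have hba := sub_pos.2 hab
  choose y hymem hysum using exists_cell_points hab hg2
  set c : ℕ → ℕ → ℝ := fun l j => g (y l j) with hc
  set W : ℕ → ℕ → ℝ := cellDev a b μ n x with hW
  set v : ℕ → ℕ → ℝ := fun l j => V (cellEnd a b l (j + 1)) - V (cellEnd a b l j) with hv
  have hV' : ∀ l, ∀ i ≤ 2 ^ l, ∀ j ≤ 2 ^ l, i ≤ j → V (cellEnd a b l i) ≤ V (cellEnd a b l j) :=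
    fun l i hi j hj hij => hV (cellEnd_mem hab hi) (cellEnd_mem hab hj) (cellEnd_mono hab l hij)
  have hv0 : ∀ l, ∀ j < 2 ^ l, 0 ≤ v l j := fun l j hj =>
    sub_nonneg.2 (hV' l j hj.le (j + 1) hj (Nat.le_succ j))
  have hvsum : ∀ l, ∑ j ∈ Finset.range (2 ^ l), v l j ≤ 1 := by
    intro l
    rw [hv, Finset.sum_range_sub (fun j => V (cellEnd a b l j)), cellEnd_zero, cellEnd_two_pow]
    exact hV1
  -- oscillation of `g` on a cell
  have hosc : ∀ l, ∀ j < 2 ^ l, ∀ s ∈ Icc (cellEnd a b l j) (cellEnd a b l (j + 1)),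
      ∀ t ∈ Icc (cellEnd a b l j) (cellEnd a b l (j + 1)), |g t - g s| ≤ v l j := by
    intro l j hj
    have hsub : Icc (cellEnd a b l j) (cellEnd a b l (j + 1)) ⊆ Icc a b :=
      Icc_subset_Icc (cellEnd_mem hab hj.le).1 (cellEnd_mem hab hj).2
    have main : ∀ s ∈ Icc (cellEnd a b l j) (cellEnd a b l (j + 1)),
        ∀ t ∈ Icc (cellEnd a b l j) (cellEnd a b l (j + 1)), s ≤ t → |g t - g s| ≤ v l j := by
      intro s hs t ht hst
      have h1 := hgV s (hsub hs) t (hsub ht) hst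
      have h2 := hV (cellEnd_mem hab hj.le) (hsub hs) hs.1
      have h3 := hV (hsub ht) (cellEnd_mem hab (l := l) (j := j + 1) hj) ht.2
      simp only [hv]; linarith
    intro s hs t ht
    rcases le_total s t with h | h
    · exact main s hs t ht h
    · rw [abs_sub_comm]; exact main t ht s hs h
  have hcsq : ∀ l, ∑ j ∈ Finset.range (2 ^ l), c l j ^ 2 ≤ H * 2 ^ l / 4 ^ K := by
    intro l
    have h := (hysum l).trans hgH
    have h2 : (0 : ℝ) < 2 ^ l := by positivity
    rw [div_mul_eq_mul_div, div_le_iff₀ h2] at h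
    have : (b - a) * ∑ j ∈ Finset.range (2 ^ l), g (y l j) ^ 2
        ≤ (b - a) * (H * 2 ^ l / 4 ^ K) := h.trans_eq (by ring)
    exact le_of_mul_le_mul_left this hba
  have hsplit : (4 : ℝ) ^ K = 2 ^ K * 2 ^ K := by rw [← mul_pow]; norm_num
  have hidx := fun l => sum_comp_cellIndex_sub_integral hab hμ hx l
  -- the linear functional
  set Λ : ℕ → ℝ := fun l => ∑ i ∈ Finset.range n, c l (cellIndex a b l (x i))
    - n * ∫ y, c l (cellIndex a b l y) ∂μ with hΛ
  -- every level contributes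
  have hlevel : ∀ k ≤ K, ∀ d : ℕ → ℝ,
      ∑ j ∈ Finset.range (2 ^ (K + k)), |d j| ≤ 2 * H →
      ∑ j ∈ Finset.range (2 ^ (K + k)), d j ^ 2 ≤ 4 * H * 2 ^ k / 2 ^ K →
      |∑ j ∈ Finset.range (2 ^ (K + k)), d j * W (K + k) j|
        ≤ 2 ^ K * (3 * H * (4 * H + 3 + τ)) * ((k + 1) * (4 / 5) ^ k) := by
    intro k hk d hd1 hd2
    have h := abs_sum_mul_le_of_sum_exp_le (2 ^ (K + k)) d (W (K + k)) (cellScale_pos K k) hd1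
      (by positivity) hd2 (hE k hk) (L := 4 * H + 3 * k + τ) (by positivity) (by
        rw [Real.exp_add, Real.exp_add]
        have h1 := Real.add_one_le_exp (4 * H)
        have h2 := eight_pow_le_exp k
        calc 4 * H * 2 ^ k / 2 ^ K * (2 ^ (K + k) * 2 ^ k * Real.exp τ)
            = 4 * H * 8 ^ k * Real.exp τ := by
              rw [show (8 : ℝ) = 2 * 2 * 2 by norm_num, mul_pow, mul_pow, pow_add]
              field_simp
          _ ≤ Real.exp (4 * H) * Real.exp (3 * k) * Real.exp τ := by
              gcongr; linarith)
    rw [inv_cellScale] at h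
    refine h.trans ?_
    have hk0 : (0 : ℝ) ≤ k := by positivity
    have : 2 * H * (4 * H + 3 * k + τ) + 3 / 2 ≤ 3 * H * (4 * H + 3 + τ) * (k + 1) := by
      nlinarith [mul_nonneg hk0 hτ, mul_nonneg hk0 (sub_nonneg.2 hH),
        mul_nonneg (mul_nonneg hk0 hτ) (sub_nonneg.2 hH),
        mul_nonneg hτ (sub_nonneg.2 hH), mul_nonneg hk0 (mul_self_nonneg H)]
    calc _ ≤ 2 ^ K * (4 / 5) ^ k * (3 * H * (4 * H + 3 + τ) * (k + 1)) := by gcongr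
      _ = _ := by ring
  have h0 : |Λ K| ≤ 2 ^ K * (3 * H * (4 * H + 3 + τ)) * (((0 : ℕ) + 1) * (4 / 5) ^ 0) := by
    simp only [hΛ]
    rw [(hidx K (c K)).2.2]
    have hsq := hcsq K
    rw [hsplit, mul_div_mul_right _ _ (by positivity)] at hsq
    refine hlevel 0 (Nat.zero_le _) (c K) ?_ ?_
    · have : ∀ j ∈ Finset.range (2 ^ K), |c K j| ≤ (2 ^ K * c K j ^ 2 + 1 / 2 ^ K) / 2 := by
        intro j _
        have h2 : (0 : ℝ) < 2 ^ K := by positivity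
        have : (2 ^ K * c K j ^ 2 + 1 / 2 ^ K) / 2 - |c K j|
            = (2 ^ K * |c K j| - 1) ^ 2 / (2 * 2 ^ K) := by
          rw [← sq_abs (c K j)]; field_simp; ring
        have : 0 ≤ (2 ^ K * |c K j| - 1) ^ 2 / (2 * 2 ^ K) := by positivity
        linarith
      refine (Finset.sum_le_sum this).trans ?_
      rw [← Finset.sum_div, Finset.sum_add_distrib, ← Finset.mul_sum, Finset.sum_const,
        Finset.card_range, nsmul_eq_mul]
      have : 2 ^ K * ∑ j ∈ Finset.range (2 ^ K), c K j ^ 2 ≤ 2 ^ K * (H / 2 ^ K) := by gcongr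
      rw [mul_div_cancel₀ _ (by positivity)] at this
      push_cast
      rw [mul_one_div_cancel (by positivity)]
      linarith
    · refine hsq.trans ?_
      rw [pow_zero, mul_one]; gcongr; linarith
  have hstep : ∀ k < K, |Λ (K + (k + 1)) - Λ (K + k)|
      ≤ 2 ^ K * (3 * H * (4 * H + 3 + τ)) * (((k + 1 : ℕ) + 1) * (4 / 5) ^ (k + 1)) := by
    intro k hk
    set d : ℕ → ℝ := fun j => c (K + (k + 1)) j - c (K + k) (j / 2) with hd
    have hdiv : ∀ j < 2 ^ (K + (k + 1)), j / 2 < 2 ^ (K + k) := by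
      intro j hj; rw [← add_assoc, pow_succ] at hj; omega
    have heq : Λ (K + (k + 1)) - Λ (K + k)
        = ∑ j ∈ Finset.range (2 ^ (K + (k + 1))), d j * W (K + (k + 1)) j := by
      rw [← (hidx (K + (k + 1)) d).2.2]
      simp only [hΛ, hd]
      rw [Finset.sum_sub_distrib]
      have hidx2 : ∀ t, cellIndex a b (K + (k + 1)) t / 2 = cellIndex a b (K + k) t :=
        cellIndex_succ_div_two (K + k)
      simp only [hidx2]
      rw [integral_sub (hidx _ _).1 (hidx _ _).1]
      ring
    have hpow : 2 ^ (K + (k + 1)) = 2 * 2 ^ (K + k) := by rw [← add_assoc, pow_succ, mul_comm]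
    rw [heq]
    refine hlevel (k + 1) hk d ?_ ?_
    · calc ∑ j ∈ Finset.range (2 ^ (K + (k + 1))), |d j|
          ≤ ∑ j ∈ Finset.range (2 ^ (K + (k + 1))), v (K + k) (j / 2) := by
            refine Finset.sum_le_sum fun j hj => ?_
            have hj' := Finset.mem_range.1 hj
            exact hosc _ _ (hdiv j hj') _ (hymem _ _ (hdiv j hj')) _
              (cell_subset_parent hab _ _ (hymem _ _ hj'))
        _ = 2 * ∑ j ∈ Finset.range (2 ^ (K + k)), v (K + k) j := by
            rw [hpow, sum_range_two_mul_div_two]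
        _ ≤ 2 * H := by have := hvsum (K + k); linarith
    · calc ∑ j ∈ Finset.range (2 ^ (K + (k + 1))), d j ^ 2
          ≤ ∑ j ∈ Finset.range (2 ^ (K + (k + 1))),
              (2 * c (K + (k + 1)) j ^ 2 + 2 * c (K + k) (j / 2) ^ 2) := by
            refine Finset.sum_le_sum fun j _ => ?_
            simp only [hd]
            nlinarith [sq_nonneg (c (K + (k + 1)) j + c (K + k) (j / 2))]
        _ = 2 * ∑ j ∈ Finset.range (2 ^ (K + (k + 1))), c (K + (k + 1)) j ^ 2
              + 2 * (2 * ∑ j ∈ Finset.range (2 ^ (K + k)), c (K + k) j ^ 2) := by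
            rw [Finset.sum_add_distrib, ← Finset.mul_sum, ← Finset.mul_sum]
            congr 2
            rw [hpow, sum_range_two_mul_div_two (fun j => c (K + k) j ^ 2)]
        _ ≤ 2 * (H * 2 ^ (K + (k + 1)) / 4 ^ K) + 2 * (2 * (H * 2 ^ (K + k) / 4 ^ K)) := by
            gcongr <;> exact hcsq _
        _ = 4 * H * 2 ^ (k + 1) / 2 ^ K := by
            rw [hsplit, pow_add, pow_add, pow_succ]; field_simp; ring
  have hchain : |Λ (K + K)| ≤ 2 ^ K * (3 * H * (4 * H + 3 + τ)) * 25 := by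
    have htel : Λ (K + K) = Λ K + ∑ k ∈ Finset.range K, (Λ (K + (k + 1)) - Λ (K + k)) := by
      rw [Finset.sum_range_sub (fun k => Λ (K + k))]; simp
    calc |Λ (K + K)| ≤ |Λ K| + ∑ k ∈ Finset.range K, |Λ (K + (k + 1)) - Λ (K + k)| := by
          rw [htel]
          exact (abs_add_le _ _).trans (by gcongr; exact Finset.abs_sum_le_sum_abs _ _)
      _ ≤ _ := add_le_add h0 (Finset.sum_le_sum fun k hk => hstep k (Finset.mem_range.1 hk))
      _ = 2 ^ K * (3 * H * (4 * H + 3 + τ))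
            * ∑ k ∈ Finset.range (K + 1), ((k : ℝ) + 1) * (4 / 5) ^ k := by
          rw [Finset.mul_sum, Finset.sum_range_succ', add_comm]
      _ ≤ _ := by gcongr; exact sum_succ_mul_four_fifths_pow_le _
  -- the remainder below the finest level
  have hrem : |(∑ i ∈ Finset.range n, g (x i) - n * ∫ y, g y ∂μ) - Λ (K + K)|
      ≤ 2 ^ K * (25 * (3 + τ)) + 2 * Q * 2 ^ K := by
    have hpt : ∀ t ∈ Ico a b, |g t - c (K + K) (cellIndex a b (K + K) t)|
        ≤ v (K + K) (cellIndex a b (K + K) t) := fun t ht =>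
      hosc _ _ (cellIndex_lt hab _ ht) _ (hymem _ _ (cellIndex_lt hab _ ht)) _
        (mem_cell hab _ ht.1)
    obtain ⟨hvi, hvint, hvW⟩ := hidx (K + K) (v (K + K))
    have hci := (hidx (K + K) (c (K + K))).1
    have hvint_le : n * ∫ y, v (K + K) (cellIndex a b (K + K) y) ∂μ ≤ Q * 2 ^ K := by
      have hQ0 : 0 ≤ Q := by
        have := measureReal_nonneg.trans (hQ 0 0 (by norm_num))
        simpa using this
      have h4 : ∫ y, v (K + K) (cellIndex a b (K + K) y) ∂μ ≤ Q / 2 ^ (K + K) := by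
        rw [hvint]
        calc _ ≤ ∑ j ∈ Finset.range (2 ^ (K + K)), v (K + K) j * (Q / 2 ^ (K + K)) := by
              refine Finset.sum_le_sum fun j hj => ?_
              have hj' := Finset.mem_range.1 hj
              exact mul_le_mul_of_nonneg_left (hQ _ _ hj') (hv0 _ _ hj')
          _ ≤ 1 * (Q / 2 ^ (K + K)) := by
              rw [← Finset.sum_mul]; gcongr; exact hvsum _
          _ = _ := one_mul _
      have hn' : (n : ℝ) ≤ 8 ^ K := by exact_mod_cast hn
      calc _ ≤ (n : ℝ) * (Q / 2 ^ (K + K)) := by gcongr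
        _ ≤ (8 : ℝ) ^ K * (Q / 2 ^ (K + K)) := by gcongr
        _ = _ := by
          rw [show (8 : ℝ) = 2 * 2 * 2 by norm_num, mul_pow, mul_pow, pow_add]; field_simp
    have hvW_le : ∑ j ∈ Finset.range (2 ^ (K + K)), v (K + K) j * W (K + K) j
        ≤ 2 ^ K * (25 * (3 + τ)) := by
      have hW_le : ∀ j < 2 ^ (K + K), W (K + K) j ≤ 2 ^ K * (25 * (3 + τ)) := by
        intro j hj
        have h1 := (Finset.single_le_sum (f := fun j => Real.exp (cellScale K K * |W (K + K) j|))
          (fun i _ => (Real.exp_pos _).le) (Finset.mem_range.2 hj)).trans (hE K le_rfl)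
        have h2 : (2 : ℝ) ^ (K + K) * 2 ^ K = 8 ^ K := by
          rw [show (8 : ℝ) = 2 * 2 * 2 by norm_num, mul_pow, mul_pow, pow_add]
        have h3 : cellScale K K * |W (K + K) j| ≤ 3 * K + τ := by
          rw [← Real.exp_le_exp, Real.exp_add]
          refine h1.trans ?_
          rw [h2]
          gcongr
          exact eight_pow_le_exp K
        have h4 : ((K : ℝ) + 1) * (4 / 5) ^ K ≤ 25 :=
          (Finset.single_le_sum (f := fun k : ℕ => ((k : ℝ) + 1) * (4 / 5) ^ k)
            (fun i _ => by positivity) (Finset.mem_range.2 (Nat.lt_succ_self K))).trans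
            (sum_succ_mul_four_fifths_pow_le _)
        calc W (K + K) j ≤ |W (K + K) j| := le_abs_self _
          _ = (cellScale K K)⁻¹ * (cellScale K K * |W (K + K) j|) := by
            rw [inv_mul_cancel_left₀ (cellScale_pos K K).ne']
          _ ≤ (cellScale K K)⁻¹ * ((3 + τ) * (K + 1)) := by
            have hK : (0 : ℝ) ≤ K := by positivity
            refine mul_le_mul_of_nonneg_left ?_ (inv_pos.2 (cellScale_pos K K)).le
            nlinarith
          _ = 2 ^ K * ((((K : ℝ) + 1) * (4 / 5) ^ K) * (3 + τ)) := by rw [inv_cellScale]; ring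
          _ ≤ _ := by gcongr
      calc _ ≤ ∑ j ∈ Finset.range (2 ^ (K + K)), v (K + K) j * (2 ^ K * (25 * (3 + τ))) := by
            refine Finset.sum_le_sum fun j hj => ?_
            have hj' := Finset.mem_range.1 hj
            exact mul_le_mul_of_nonneg_left (hW_le j hj') (hv0 _ _ hj')
        _ ≤ 1 * (2 ^ K * (25 * (3 + τ))) := by
            rw [← Finset.sum_mul]; gcongr; exact hvsum _
        _ = _ := one_mul _
    have hA : |∑ i ∈ Finset.range n, g (x i)
        - ∑ i ∈ Finset.range n, c (K + K) (cellIndex a b (K + K) (x i))|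
        ≤ ∑ i ∈ Finset.range n, v (K + K) (cellIndex a b (K + K) (x i)) := by
      rw [← Finset.sum_sub_distrib]
      exact (Finset.abs_sum_le_sum_abs _ _).trans
        (Finset.sum_le_sum fun i hi => hpt _ (hx i (Finset.mem_range.1 hi)))
    have hB : |n * ∫ y, g y ∂μ - n * ∫ y, c (K + K) (cellIndex a b (K + K) y) ∂μ|
        ≤ n * ∫ y, v (K + K) (cellIndex a b (K + K) y) ∂μ := by
      rw [← mul_sub, abs_mul, Nat.abs_cast, ← integral_sub hg hci]
      gcongr
      refine (abs_integral_le_integral_abs).trans ?_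
      refine integral_mono_ae (hg.sub hci).abs hvi ?_
      filter_upwards [hμ] with t ht using hpt t ht
    have hΛK : Λ (K + K) = ∑ i ∈ Finset.range n, c (K + K) (cellIndex a b (K + K) (x i))
      - n * ∫ y, c (K + K) (cellIndex a b (K + K) y) ∂μ := rfl
    rw [hΛK]
    rw [abs_le] at hA hB ⊢
    constructor <;> linarith [hA.1, hA.2, hB.1, hB.2]
  have h2K : (0 : ℝ) < 2 ^ K := by positivity
  have := abs_sub_abs_le_abs_sub (∑ i ∈ Finset.range n, g (x i) - n * ∫ y, g y ∂μ) (Λ (K + K))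
  have hfin : 2 ^ K * (3 * H * (4 * H + 3 + τ)) * 25
      + (2 ^ K * (25 * (3 + τ)) + 2 * Q * 2 ^ K)
      ≤ (100 * H * (4 * H + 5 + τ) + 2 * Q) * 2 ^ K := by
    have : 25 * (3 + τ) ≤ 25 * H * (4 * H + 5 + τ) := by nlinarith [mul_nonneg hτ (sub_nonneg.2 hH)]
    nlinarith
  linarith

end Cells

section ExponentialMoments

open ProbabilityTheory

variable {Ω : Type*} [MeasurableSpace Ω] {P : Measure Ω} {a b : ℝ} {μ : Measure ℝ} {X : ℕ → Ω → ℝ}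

theorem exp_mul_abs_le (t u : ℝ) :
    Real.exp (t * |u|) ≤ Real.exp (t * u) + Real.exp (-t * u) := by
  rcases abs_cases u with ⟨h, _⟩ | ⟨h, _⟩ <;> rw [h]
  · linarith [Real.exp_pos (-t * u)]
  · rw [mul_neg, ← neg_mul]; linarith [Real.exp_pos (t * u)]

theorem mgf_indicator_sub_measureReal_le [IsProbabilityMeasure μ] {S : Set ℝ}
    (hS : MeasurableSet S) {t : ℝ} (ht : |t| ≤ 1) :
    mgf (fun y => (S.indicator 1 y : ℝ) - μ.real S) μ t ≤ Real.exp (μ.real S * t ^ 2) := by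
  set p := μ.real S with hp
  have hp0 : 0 ≤ p := measureReal_nonneg
  have hp1 : p ≤ 1 := measureReal_le_one
  have hI : Integrable (S.indicator (1 : ℝ → ℝ)) μ := (integrable_const (1 : ℝ)).indicator hS
  have hpt : ∀ y, Real.exp (t * ((S.indicator 1 y : ℝ) - p))
      ≤ 1 + t * ((S.indicator 1 y : ℝ) - p) + t ^ 2 * ((1 - 2 * p) * S.indicator 1 y + p ^ 2) := by
    intro y
    have hz : |(S.indicator 1 y : ℝ) - p| ≤ 1 ∧
        ((S.indicator 1 y : ℝ) - p) ^ 2 = (1 - 2 * p) * S.indicator 1 y + p ^ 2 := by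
      by_cases hy : y ∈ S
      · simp only [Set.indicator_of_mem hy, Pi.one_apply]
        exact ⟨abs_le.2 ⟨by linarith, by linarith⟩, by ring⟩
      · simp only [Set.indicator_of_notMem hy]
        exact ⟨abs_le.2 ⟨by linarith, by linarith⟩, by ring⟩
    have h1 : |t * ((S.indicator 1 y : ℝ) - p)| ≤ 1 := by
      rw [abs_mul]; exact mul_le_one₀ ht (abs_nonneg _) hz.1
    have h2 := (abs_le.1 (Real.abs_exp_sub_one_sub_id_le h1)).2
    rw [mul_pow, hz.2] at h2
    linarith
  have hint : Integrable (fun y => 1 + t * ((S.indicator 1 y : ℝ) - p)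
      + t ^ 2 * ((1 - 2 * p) * S.indicator 1 y + p ^ 2)) μ := by
    refine ((integrable_const _).add ((hI.sub (integrable_const _)).const_mul _)).add
      (((hI.const_mul _).add (integrable_const _)).const_mul _)
  have hval : ∫ y, (1 + t * ((S.indicator 1 y : ℝ) - p)
      + t ^ 2 * ((1 - 2 * p) * S.indicator 1 y + p ^ 2)) ∂μ = 1 + t ^ 2 * (p - p ^ 2) := by
    have : (fun y => 1 + t * ((S.indicator 1 y : ℝ) - p)
        + t ^ 2 * ((1 - 2 * p) * S.indicator 1 y + p ^ 2))
        = fun y => (t + t ^ 2 * (1 - 2 * p)) * S.indicator (1 : ℝ → ℝ) y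
          + (1 - t * p + t ^ 2 * p ^ 2) := by ext y; ring
    rw [this, integral_add (hI.const_mul _) (integrable_const _), integral_const_mul,
      integral_indicator_one hS, integral_const, ← hp]
    simp
    ring
  unfold mgf
  calc _ ≤ 1 + t ^ 2 * (p - p ^ 2) := by
        rw [← hval]
        exact integral_mono_of_nonneg (Filter.Eventually.of_forall fun y => (Real.exp_pos _).le)
          hint (Filter.Eventually.of_forall hpt)
    _ ≤ p * t ^ 2 + 1 := by nlinarith [sq_nonneg (t * p)]
    _ ≤ _ := Real.add_one_le_exp _

theorem measurable_cellDev (hX : ∀ i, Measurable (X i)) (n l j : ℕ) :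
    Measurable fun ω => cellDev a b μ n (fun i => X i ω) l j := by
  unfold cellDev
  refine Finset.measurable_sum _ fun i _ => Measurable.sub_const ?_ _
  exact (measurable_one.indicator (measurable_cellIndex l (measurableSet_singleton j))).comp (hX i)

theorem abs_cellDev_le [IsProbabilityMeasure μ] (n : ℕ) (x : ℕ → ℝ) (l j : ℕ) :
    |cellDev a b μ n x l j| ≤ n := by
  unfold cellDev
  refine (Finset.abs_sum_le_sum_abs _ _).trans ?_
  calc _ ≤ ∑ i ∈ Finset.range n, (1 : ℝ) := Finset.sum_le_sum fun i _ => ?_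
    _ = n := by simp
  have hp0 : 0 ≤ μ.real {y | cellIndex a b l y = j} := measureReal_nonneg
  have hp1 : μ.real {y | cellIndex a b l y = j} ≤ 1 := measureReal_le_one
  by_cases hy : x i ∈ {y | cellIndex a b l y = j}
  · rw [Set.indicator_of_mem hy, Pi.one_apply]
    exact abs_le.2 ⟨by linarith, by linarith⟩
  · rw [Set.indicator_of_notMem hy]
    exact abs_le.2 ⟨by linarith, by linarith⟩

theorem integrable_exp_mul_cellDev [IsProbabilityMeasure P] [IsProbabilityMeasure μ]
    (hX : ∀ i, Measurable (X i)) (n l j : ℕ) (t : ℝ) :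
    Integrable (fun ω => Real.exp (t * cellDev a b μ n (fun i => X i ω) l j)) P :=
  integrable_exp_mul_of_mem_Icc (a := -n) (b := n) (measurable_cellDev hX n l j).aemeasurable
    (Filter.Eventually.of_forall fun _ => abs_le.1 (abs_cellDev_le n _ l j))

theorem mgf_cellDev_le [IsProbabilityMeasure μ] (hX : ∀ i, Measurable (X i))
    (hlaw : ∀ i, P.map (X i) = μ) (hind : iIndepFun X P) (n l j : ℕ) {t : ℝ} (ht : |t| ≤ 1) :
    mgf (fun ω => cellDev a b μ n (fun i => X i ω) l j) P t
      ≤ Real.exp (n * μ.real {y | cellIndex a b l y = j} * t ^ 2) := by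
  set S := {y | cellIndex a b l y = j} with hS
  have hSm : MeasurableSet S := measurable_cellIndex l (measurableSet_singleton j)
  set φ : ℝ → ℝ := fun y => S.indicator 1 y - μ.real S with hφ
  have hφm : Measurable φ := (measurable_one.indicator hSm).sub_const _
  have hsum : (fun ω => cellDev a b μ n (fun i => X i ω) l j)
      = ∑ i ∈ Finset.range n, φ ∘ X i := by
    ext ω; simp [cellDev, hφ, hS]
  rw [hsum, (hind.comp (fun _ => φ) fun _ => hφm).mgf_sum fun i => hφm.comp (hX i)]
  have hone : ∀ i ∈ Finset.range n, mgf (φ ∘ X i) P t ≤ Real.exp (μ.real S * t ^ 2) := by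
    intro i _
    have : mgf (φ ∘ X i) P t = mgf φ μ t := by
      unfold mgf
      rw [← hlaw i, integral_map (hX i).aemeasurable (by fun_prop)]
      rfl
    rw [this]
    exact mgf_indicator_sub_measureReal_le hSm ht
  refine (Finset.prod_le_prod (fun i _ => mgf_nonneg) hone).trans_eq ?_
  rw [Finset.prod_const, Finset.card_range, ← Real.exp_nat_mul]
  ring_nf

theorem cellScale_le_one {K k : ℕ} (hk : k ≤ K) : cellScale K k ≤ 1 := by
  unfold cellScale
  rw [div_le_one (by positivity)]
  calc (5 / 4 : ℝ) ^ k ≤ (5 / 4) ^ K := pow_le_pow_right₀ (by norm_num) hk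
    _ ≤ 2 ^ K := by gcongr; norm_num

theorem integral_sum_exp_abs_cellDev_le [IsProbabilityMeasure P] [IsProbabilityMeasure μ]
    (hX : ∀ i, Measurable (X i)) (hlaw : ∀ i, P.map (X i) = μ) (hind : iIndepFun X P) {Q : ℝ}
    (hQ : ∀ l, ∀ j < 2 ^ l, μ.real {y | cellIndex a b l y = j} ≤ Q / 2 ^ l)
    {n K k : ℕ} (hn : n ≤ 8 ^ K) (hk : k ≤ K) :
    Integrable (fun ω => ∑ j ∈ Finset.range (2 ^ (K + k)),
      Real.exp (cellScale K k * |cellDev a b μ n (fun i => X i ω) (K + k) j|)) P ∧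
    ∫ ω, ∑ j ∈ Finset.range (2 ^ (K + k)),
      Real.exp (cellScale K k * |cellDev a b μ n (fun i => X i ω) (K + k) j|) ∂P
      ≤ 2 ^ (K + k) * (2 * Real.exp Q) := by
  have hθ0 := cellScale_pos K k
  have hint : ∀ j, Integrable (fun ω =>
      Real.exp (cellScale K k * |cellDev a b μ n (fun i => X i ω) (K + k) j|)) P := fun j =>
    integrable_exp_mul_abs (integrable_exp_mul_cellDev hX _ _ _ _)
      (integrable_exp_mul_cellDev hX _ _ _ _)
  refine ⟨integrable_finsetSum _ fun j _ => hint j, ?_⟩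
  rw [integral_finsetSum _ fun j _ => hint j]
  calc _ ≤ ∑ j ∈ Finset.range (2 ^ (K + k)), 2 * Real.exp Q := Finset.sum_le_sum fun j hj => ?_
    _ = _ := by simp
  have hexp : n * μ.real {y | cellIndex a b (K + k) y = j} * cellScale K k ^ 2 ≤ Q := by
    have hQ0 : 0 ≤ Q := by simpa using measureReal_nonneg.trans (hQ 0 0 (by norm_num))
    have hn' : (n : ℝ) ≤ 8 ^ K := by exact_mod_cast hn
    calc _ ≤ 8 ^ K * (Q / 2 ^ (K + k)) * cellScale K k ^ 2 := by
          gcongr; exact hQ _ _ (Finset.mem_range.1 hj)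
      _ = Q * ((25 / 16) ^ k / 2 ^ k) := by
          unfold cellScale
          rw [show (8 : ℝ) = 2 * 2 * 2 by norm_num, mul_pow, mul_pow, pow_add, div_pow, ← pow_mul,
            mul_comm k 2, pow_mul]
          norm_num
          field_simp
      _ ≤ Q * 1 := by
          gcongr
          rw [div_le_one (by positivity)]
          gcongr; norm_num
      _ = Q := mul_one Q
  have hmgf : ∀ t, t ^ 2 = cellScale K k ^ 2 → |t| ≤ 1 →
      ∫ ω, Real.exp (t * cellDev a b μ n (fun i => X i ω) (K + k) j) ∂P ≤ Real.exp Q := by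
    intro t ht ht1
    refine (mgf_cellDev_le hX hlaw hind n (K + k) j ht1).trans ?_
    rw [ht]
    exact Real.exp_le_exp.2 hexp
  have habs : |cellScale K k| ≤ 1 := by rw [abs_of_pos hθ0]; exact cellScale_le_one hk
  have h1 := hmgf (cellScale K k) rfl habs
  have h2 := hmgf (-cellScale K k) (neg_sq _) (by rwa [abs_neg])
  have hi := fun t =>
    integrable_exp_mul_cellDev (P := P) (a := a) (b := b) (μ := μ) hX n (K + k) j t
  calc _ ≤ ∫ ω, (Real.exp (cellScale K k * cellDev a b μ n (fun i => X i ω) (K + k) j)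
        + Real.exp (-cellScale K k * cellDev a b μ n (fun i => X i ω) (K + k) j)) ∂P := by
        refine integral_mono (hint j) ((hi _).add (hi _)) fun ω => ?_
        exact exp_mul_abs_le _ _
    _ ≤ _ := by rw [integral_add (hi _) (hi _)]; linarith

theorem measureReal_exists_le_sum_exp_le [IsProbabilityMeasure P] [IsProbabilityMeasure μ]
    (hX : ∀ i, Measurable (X i)) (hlaw : ∀ i, P.map (X i) = μ) (hind : iIndepFun X P) {Q : ℝ}
    (hQ : ∀ l, ∀ j < 2 ^ l, μ.real {y | cellIndex a b l y = j} ≤ Q / 2 ^ l)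
    {n K : ℕ} (hn : n ≤ 8 ^ K) (τ : ℝ) :
    P.real (⋃ k ∈ Finset.range (K + 1), {ω | 2 ^ (K + k) * 2 ^ k * Real.exp τ ≤
      ∑ j ∈ Finset.range (2 ^ (K + k)),
        Real.exp (cellScale K k * |cellDev a b μ n (fun i => X i ω) (K + k) j|)})
      ≤ 4 * Real.exp Q * Real.exp (-τ) := by
  refine (measureReal_biUnion_finset_le _ _).trans ?_
  calc _ ≤ ∑ k ∈ Finset.range (K + 1), (2 * Real.exp Q * Real.exp (-τ)) * (1 / 2) ^ k := by
        refine Finset.sum_le_sum fun k hk => ?_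
        obtain ⟨hint, hle⟩ := integral_sum_exp_abs_cellDev_le hX hlaw hind hQ hn
          (Nat.lt_succ_iff.1 (Finset.mem_range.1 hk))
        have h := (mul_meas_ge_le_integral_of_nonneg (Filter.Eventually.of_forall fun ω =>
          Finset.sum_nonneg fun j _ => (Real.exp_pos _).le) hint
          (2 ^ (K + k) * 2 ^ k * Real.exp τ)).trans hle
        rw [← le_div_iff₀' (by positivity)] at h
        refine h.trans_eq ?_
        rw [Real.exp_neg, one_div, inv_pow]
        field_simp
    _ ≤ (2 * Real.exp Q * Real.exp (-τ)) * 2 := by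
        rw [← Finset.mul_sum]
        gcongr
        exact sum_geometric_two_le _
    _ = _ := by ring

end ExponentialMoments

section Densities

variable {a b : ℝ} {f f₀ : ℝ → ℝ}

theorem InF.log_sub_log_le (hf : InF a b f) {s t : ℝ} (hs : s ∈ Icc a b) (ht : t ∈ Icc a b) :
    |Real.log (f t) - Real.log (f s)|
      ≤ (eVariationOn (fun t => Real.log (f t)) (Icc a b)).toReal :=
  BoundedVariationOn.dist_le hf.2.2.2 ht hs

theorem InF.exists_bounds (hab : a < b) (hf : InF a b f) :
    ∃ q > 0, ∃ Q > 0, ∀ t ∈ Icc a b, q ≤ f t ∧ f t ≤ Q := by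
  have ha : a ∈ Icc a b := left_mem_Icc.2 hab.le
  have hfa := hf.1 a ha
  set v := (eVariationOn (fun t => Real.log (f t)) (Icc a b)).toReal
  refine ⟨Real.exp (Real.log (f a) - v), Real.exp_pos _, Real.exp (Real.log (f a) + v),
    Real.exp_pos _, fun t ht => ?_⟩
  have h := abs_le.1 (hf.log_sub_log_le ha ht)
  rw [← Real.le_log_iff_exp_le (hf.1 t ht), ← Real.log_le_iff_le_exp (hf.1 t ht)]
  exact ⟨by linarith [h.1], by linarith [h.2]⟩

theorem one_le_Jfun (a b : ℝ) (f₀ f : ℝ → ℝ) : 1 ≤ Jfun a b f₀ f := by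
  unfold Jfun
  linarith [ENNReal.toReal_nonneg (a := eVariationOn (fun t => Real.log (f t)) (Icc a b)),
    ENNReal.toReal_nonneg (a := eVariationOn (fun t => Real.log (f₀ t)) (Icc a b))]

theorem abs_pfun_sub_pfun_le {s t : ℝ} (hs : 0 < f s) (ht : 0 < f t) (hs₀ : 0 < f₀ s)
    (ht₀ : 0 < f₀ t) :
    |pfun f₀ f t - pfun f₀ f s|
      ≤ |Real.log (f t) - Real.log (f s)| + |Real.log (f₀ t) - Real.log (f₀ s)| := by
  have main : ∀ s t : ℝ, 0 < f s → 0 < f t → 0 < f₀ s → 0 < f₀ t →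
      pfun f₀ f t - pfun f₀ f s
        ≤ |Real.log (f t) - Real.log (f s)| + |Real.log (f₀ t) - Real.log (f₀ s)| := by
    intro s t hs ht hs₀ ht₀
    set D := |Real.log (f t) - Real.log (f s)| + |Real.log (f₀ t) - Real.log (f₀ s)| with hD
    have hD0 : 0 ≤ D := by positivity
    have hratio : f t / f₀ t ≤ Real.exp D * (f s / f₀ s) := by
      rw [← Real.log_le_log_iff (by positivity) (by positivity),
        Real.log_mul (by positivity) (by positivity), Real.log_exp,
        Real.log_div ht.ne' ht₀.ne', Real.log_div hs.ne' hs₀.ne']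
      have h1 := le_abs_self (Real.log (f t) - Real.log (f s))
      have h2 := neg_abs_le (Real.log (f₀ t) - Real.log (f₀ s))
      linarith
    have hE : 1 ≤ Real.exp D := Real.one_le_exp hD0
    have harg : (f t + f₀ t) / (2 * f₀ t) ≤ Real.exp D * ((f s + f₀ s) / (2 * f₀ s)) := by
      have e1 : (f t + f₀ t) / (2 * f₀ t) = (f t / f₀ t + 1) / 2 := by field_simp
      have e2 : (f s + f₀ s) / (2 * f₀ s) = (f s / f₀ s + 1) / 2 := by field_simp
      rw [e1, e2]; linarith
    have hlog := Real.log_le_log (by positivity) harg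
    rw [Real.log_mul (by positivity) (by positivity), Real.log_exp] at hlog
    unfold pfun
    linarith
  rw [abs_le]
  constructor
  · have := main t s ht hs ht₀ hs₀
    rw [abs_sub_comm (Real.log (f s)), abs_sub_comm (Real.log (f₀ s))] at this
    linarith
  · exact main s t hs ht hs₀ ht₀

theorem sq_pfun_mul_le {t : ℝ} (ht : 0 < f t) (ht₀ : 0 < f₀ t) :
    pfun f₀ f t ^ 2 * f₀ t ≤ (Real.sqrt (f t) - Real.sqrt (f₀ t)) ^ 2 := by
  obtain ⟨u, hu, hu2⟩ : ∃ u, 0 < u ∧ f t = u ^ 2 :=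
    ⟨Real.sqrt (f t), Real.sqrt_pos.2 ht, (Real.sq_sqrt ht.le).symm⟩
  obtain ⟨w, hw, hw2⟩ : ∃ w, 0 < w ∧ f₀ t = w ^ 2 :=
    ⟨Real.sqrt (f₀ t), Real.sqrt_pos.2 ht₀, (Real.sq_sqrt ht₀.le).symm⟩
  have habs : |pfun f₀ f t| * w ≤ |u - w| := by
    unfold pfun
    rw [hu2, hw2]
    rcases le_total w u with h | h
    · have h1 : 1 ≤ (u ^ 2 + w ^ 2) / (2 * w ^ 2) := by
        rw [le_div_iff₀ (by positivity)]; nlinarith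
      have h2 : (u ^ 2 + w ^ 2) / (2 * w ^ 2) ≤ (u / w) ^ 2 := by
        rw [div_pow, div_le_div_iff₀ (by positivity) (by positivity)]
        nlinarith [mul_pos hw hw,
          mul_nonneg (sq_nonneg w) (mul_nonneg (sub_nonneg.2 h) (add_pos hu hw).le)]
      have h3 := Real.log_le_log (by positivity) h2
      rw [Real.log_pow] at h3
      have h4 := Real.log_le_sub_one_of_pos (show 0 < u / w by positivity)
      rw [abs_of_nonneg (mul_nonneg (by norm_num) (Real.log_nonneg h1)),
        abs_of_nonneg (sub_nonneg.2 h)]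
      push_cast at h3
      calc _ ≤ (u / w - 1) * w := by gcongr; linarith
        _ = u - w := by field_simp
    · have h1 : (u ^ 2 + w ^ 2) / (2 * w ^ 2) ≤ 1 := by
        rw [div_le_one (by positivity)]; nlinarith
      have h2 := Real.one_sub_inv_le_log_of_pos
        (show 0 < (u ^ 2 + w ^ 2) / (2 * w ^ 2) by positivity)
      rw [inv_div] at h2
      rw [abs_of_nonpos (mul_nonpos_of_nonneg_of_nonpos (by norm_num)
        (Real.log_nonpos (by positivity) h1)), abs_of_nonpos (sub_nonpos.2 h)]
      have h3 : 2 * w ^ 2 / (u ^ 2 + w ^ 2) - 1 ≤ 2 * (w - u) / w := by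
        rw [div_sub_one (by positivity), div_le_div_iff₀ (by positivity) hw]
        nlinarith [mul_nonneg (sub_nonneg.2 h) (sq_nonneg (u - w)),
          mul_nonneg (sub_nonneg.2 h) (sq_nonneg u), mul_nonneg (sub_nonneg.2 h) (sq_nonneg w),
          mul_nonneg (sub_nonneg.2 h) (mul_pos hu hw).le]
      calc _ ≤ ((w - u) / w) * w := by
            gcongr
            rw [mul_div_assoc 2 (w - u)] at h3
            linarith
        _ = _ := by field_simp; ring
  have h := mul_self_le_mul_self (by positivity) habs
  rw [hu2, hw2, Real.sqrt_sq hu.le, Real.sqrt_sq hw.le, ← sq_abs (pfun f₀ f t), ← sq_abs (u - w)]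
  calc _ = |pfun f₀ f t| * w * (|pfun f₀ f t| * w) := by ring
    _ ≤ _ := by rw [sq]; exact h

theorem aemeasurable_pfun (hf : InF a b f) (hf₀ : InF a b f₀) :
    AEMeasurable (pfun f₀ f) (volume.restrict (Icc a b)) := by
  have h1 := hf.2.1.aemeasurable
  have h2 := hf₀.2.1.aemeasurable
  exact (Real.measurable_log.comp_aemeasurable ((h1.add h2).div (h2.const_mul 2))).const_mul _

theorem abs_pfun_le (hab : a < b) (hf : InF a b f) (hf₀ : InF a b f₀) :
    ∃ C, ∀ t ∈ Icc a b, |pfun f₀ f t| ≤ C := by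
  have ha : a ∈ Icc a b := left_mem_Icc.2 hab.le
  refine ⟨|pfun f₀ f a| + ((eVariationOn (fun t => Real.log (f t)) (Icc a b)).toReal
    + (eVariationOn (fun t => Real.log (f₀ t)) (Icc a b)).toReal), fun t ht => ?_⟩
  have h1 := abs_pfun_sub_pfun_le (hf.1 a ha) (hf.1 t ht) (hf₀.1 a ha) (hf₀.1 t ht)
  have h2 := (abs_sub_abs_le_abs_sub _ _).trans
    (h1.trans (add_le_add (hf.log_sub_log_le ha ht) (hf₀.log_sub_log_le ha ht)))
  exact sub_le_iff_le_add'.1 h2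

theorem integral_sq_pfun_mul_le (hab : a < b) (hf : InF a b f) (hf₀ : InF a b f₀) {q : ℝ}
    (hq : ∀ t ∈ Icc a b, q ≤ f₀ t) :
    IntegrableOn (fun t => pfun f₀ f t ^ 2) (Icc a b) ∧
      (∫ t in Icc a b, pfun f₀ f t ^ 2) * q ≤ 2 * hell a b f f₀ ^ 2 := by
  obtain ⟨C, hC⟩ := abs_pfun_le hab hf hf₀
  have hint : IntegrableOn (fun t => pfun f₀ f t ^ 2) (Icc a b) := by
    refine Integrable.of_bound ((aemeasurable_pfun hf hf₀).pow_const 2).aestronglyMeasurable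
      (C ^ 2) ?_
    filter_upwards [ae_restrict_mem measurableSet_Icc] with t ht
    rw [Real.norm_eq_abs, abs_pow]
    exact pow_le_pow_left₀ (abs_nonneg _) (hC t ht) 2
  refine ⟨hint, ?_⟩
  have hint2 : IntegrableOn (fun t => (Real.sqrt (f t) - Real.sqrt (f₀ t)) ^ 2) (Icc a b) := by
    refine Integrable.mono' (hf.2.1.add hf₀.2.1) ((hf.2.1.aemeasurable.sqrt.sub
      hf₀.2.1.aemeasurable.sqrt).pow_const 2).aestronglyMeasurable ?_
    filter_upwards [ae_restrict_mem measurableSet_Icc] with t ht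
    rw [Real.norm_eq_abs, abs_of_nonneg (sq_nonneg _), Pi.add_apply]
    nlinarith [Real.sq_sqrt (hf.1 t ht).le, Real.sq_sqrt (hf₀.1 t ht).le,
      mul_nonneg (Real.sqrt_nonneg (f t)) (Real.sqrt_nonneg (f₀ t))]
  unfold hell
  rw [Real.sq_sqrt (mul_nonneg (by norm_num) (integral_nonneg fun t => sq_nonneg _)),
    ← integral_mul_const, ← mul_assoc, mul_one_div_cancel (by norm_num), one_mul]
  refine setIntegral_mono_on (hint.mul_const q) hint2 measurableSet_Icc fun t ht => ?_
  exact (mul_le_mul_of_nonneg_left (hq t ht) (sq_nonneg _)).trans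
    (sq_pfun_mul_le (hf.1 t ht) (hf₀.1 t ht))

/-- A monotone function witnessing the total variation of `log f`. -/
theorem InF.exists_monotoneOn (hab : a < b) (hf : InF a b f) :
    ∃ V : ℝ → ℝ, MonotoneOn V (Icc a b) ∧
      V b - V a = (eVariationOn (fun t => Real.log (f t)) (Icc a b)).toReal ∧
      ∀ s ∈ Icc a b, ∀ t ∈ Icc a b, s ≤ t → |Real.log (f t) - Real.log (f s)| ≤ V t - V s := by
  have ha : a ∈ Icc a b := left_mem_Icc.2 hab.le
  have hbv : BoundedVariationOn (fun t => Real.log (f t)) (Icc a b) := hf.2.2.2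
  have hlbv := hbv.locallyBoundedVariationOn
  refine ⟨variationOnFromTo (fun t => Real.log (f t)) (Icc a b) a,
    variationOnFromTo.monotoneOn hlbv ha, ?_, fun s hs t ht hst => ?_⟩
  · rw [variationOnFromTo.self, sub_zero, variationOnFromTo.eq_of_le _ _ hab.le, inter_self]
  · rw [← variationOnFromTo.add hlbv ha hs ht, add_sub_cancel_left,
      variationOnFromTo.eq_of_le _ _ hst]
    exact BoundedVariationOn.dist_le (hbv.mono inter_subset_left)
      ⟨ht, right_mem_Icc.2 hst⟩ ⟨hs, left_mem_Icc.2 hst⟩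

/-- The probability measure with density `f₀` on `[a, b]`. -/
noncomputable abbrev densityMeasure (a b : ℝ) (f₀ : ℝ → ℝ) : Measure ℝ :=
  (volume.restrict (Icc a b)).withDensity fun t => ENNReal.ofReal (f₀ t)

theorem ae_densityMeasure_mem_Ico (a b : ℝ) (f₀ : ℝ → ℝ) :
    ∀ᵐ y ∂densityMeasure a b f₀, y ∈ Ico a b := by
  refine (withDensity_absolutelyContinuous _ _).ae_le ?_
  rw [← Measure.restrict_congr_set Ico_ae_eq_Icc]
  exact ae_restrict_mem measurableSet_Ico

theorem densityMeasure_cell_le (hab : a < b) {Q : ℝ} (hQ0 : 0 ≤ Q)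
    (hQ : ∀ t ∈ Icc a b, f₀ t ≤ Q) {l j : ℕ} :
    (densityMeasure a b f₀).real {y | cellIndex a b l y = j} ≤ Q * (b - a) / 2 ^ l := by
  have hSm : MeasurableSet {y | cellIndex a b l y = j} :=
    measurable_cellIndex l (measurableSet_singleton j)
  have hba := sub_pos.2 hab
  have hnn : 0 ≤ (b - a) / 2 ^ l := by positivity
  refine ENNReal.toReal_le_of_le_ofReal (by positivity) ?_
  rw [withDensity_apply _ hSm, Measure.restrict_restrict hSm]
  calc _ ≤ ∫⁻ _ in {y | cellIndex a b l y = j} ∩ Icc a b, ENNReal.ofReal Q := by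
        refine setLIntegral_mono' (hSm.inter measurableSet_Icc) fun t ht => ?_
        exact ENNReal.ofReal_le_ofReal (hQ t ht.2)
    _ = ENNReal.ofReal Q * volume ({y | cellIndex a b l y = j} ∩ Icc a b) := by
        rw [setLIntegral_const]
    _ ≤ ENNReal.ofReal Q * ENNReal.ofReal ((b - a) / 2 ^ l) := by
        gcongr
        rw [← cellEnd_succ_sub l j, ← Real.volume_Icc]
        refine measure_mono ?_
        rintro t ⟨rfl, ht⟩
        exact mem_cell hab l ht.1
    _ = _ := by rw [← ENNReal.ofReal_mul hQ0]; ring_nf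

theorem integral_densityMeasure (hf₀ : InF a b f₀) (g : ℝ → ℝ) :
    ∫ y, g y ∂densityMeasure a b f₀ = ∫ t in Icc a b, g t * f₀ t := by
  rw [integral_withDensity_eq_integral_toReal_smul₀ hf₀.2.1.aemeasurable.ennreal_ofReal
    (Filter.Eventually.of_forall fun _ => ENNReal.ofReal_lt_top)]
  refine setIntegral_congr_fun measurableSet_Icc fun t ht => ?_
  rw [ENNReal.toReal_ofReal (hf₀.1 t ht).le, smul_eq_mul, mul_comm]

/-- The chaining bound, applied to the normalized function `p_f / J(f)`. -/
theorem abs_sum_pfun_sub_integral_le (hab : a < b) (hf₀ : InF a b f₀)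
    [IsProbabilityMeasure (densityMeasure a b f₀)] {q Q : ℝ} (hq0 : 0 < q) (hQ0 : 0 < Q)
    (hqQ : ∀ t ∈ Icc a b, q ≤ f₀ t ∧ f₀ t ≤ Q) {n K : ℕ} (hn : n ≤ 8 ^ K) {x : ℕ → ℝ}
    (hx : ∀ i < n, x i ∈ Ico a b) {τ : ℝ} (hτ : 0 ≤ τ)
    (hE : ∀ k ≤ K, ∑ j ∈ Finset.range (2 ^ (K + k)),
      Real.exp (cellScale K k * |cellDev a b (densityMeasure a b f₀) n x (K + k) j|)
        ≤ 2 ^ (K + k) * 2 ^ k * Real.exp τ)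
    (hf : InF a b f) (hh : hell a b f f₀ ≤ 2 / 2 ^ K * Jfun a b f₀ f) {H : ℝ}
    (hH : H = 1 + 8 / (q * (b - a))) :
    |∑ i ∈ Finset.range n, pfun f₀ f (x i) - n * ∫ t in Icc a b, pfun f₀ f t * f₀ t|
      ≤ (100 * H * (4 * H + 5 + τ) + 2 * (Q * (b - a))) * 2 ^ K * Jfun a b f₀ f := by
  have hba := sub_pos.2 hab
  set J := Jfun a b f₀ f with hJ
  have hJ0 : 0 < J := one_pos.trans_le (one_le_Jfun a b f₀ f)
  obtain ⟨hint2, hle⟩ := integral_sq_pfun_mul_le hab hf hf₀ fun t ht => (hqQ t ht).1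
  obtain ⟨V, hV, hVv, hVle⟩ := hf.exists_monotoneOn hab
  obtain ⟨V₀, hV₀, hVv₀, hVle₀⟩ := hf₀.exists_monotoneOn hab
  obtain ⟨C, hC⟩ := abs_pfun_le hab hf hf₀
  have hpint : Integrable (pfun f₀ f) (densityMeasure a b f₀) := by
    have hmeas := (aemeasurable_pfun hf hf₀).mono_ac
      (withDensity_absolutelyContinuous _ fun t => ENNReal.ofReal (f₀ t))
    refine Integrable.of_bound hmeas.aestronglyMeasurable C ?_
    filter_upwards [ae_densityMeasure_mem_Ico a b f₀] with t ht using hC t (Ico_subset_Icc_self ht)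
  have hmain := abs_sum_sub_integral_le hab (ae_densityMeasure_mem_Ico a b f₀)
    (fun l j _ => densityMeasure_cell_le hab hQ0.le (fun t ht => (hqQ t ht).2)) hn hx
    (H := H) (by rw [hH]; have : 0 < 8 / (q * (b - a)) := by positivity
                 linarith) hτ hE
    (g := fun t => J⁻¹ * pfun f₀ f t) (V := fun t => J⁻¹ * (V t + V₀ t))
    (hpint.const_mul _) (by simp only [mul_pow]; exact hint2.const_mul _) ?_ ?_ ?_ ?_
  · rw [← Finset.mul_sum, integral_const_mul, mul_left_comm, ← mul_sub, abs_mul,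
      abs_of_pos (inv_pos.2 hJ0), integral_densityMeasure hf₀, inv_mul_le_iff₀ hJ0] at hmain
    linarith
  · simp only [mul_pow]
    rw [integral_const_mul]
    have h0 : 0 ≤ hell a b f f₀ := Real.sqrt_nonneg _
    have h4 : (4 : ℝ) ^ K = 2 ^ K * 2 ^ K := by rw [← mul_pow]; norm_num
    have h1 := hle.trans (mul_le_mul_of_nonneg_left (pow_le_pow_left₀ h0 hh 2) zero_le_two)
    rw [← le_div_iff₀ hq0] at h1
    calc _ ≤ J⁻¹ ^ 2 * (2 * (2 / 2 ^ K * J) ^ 2 / q) := by gcongr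
      _ = (b - a) * (8 / (q * (b - a))) / 4 ^ K := by
        rw [h4]; field_simp; norm_num
      _ ≤ (b - a) * H / 4 ^ K := by gcongr; rw [hH]; linarith
  · intro s hs t ht hst
    have := hV hs ht hst
    have := hV₀ hs ht hst
    simp only
    gcongr
  · rw [← mul_sub, inv_mul_le_iff₀ hJ0, mul_one]
    simp only [hJ, Jfun]
    linarith
  · intro s hs t ht hst
    rw [← mul_sub, ← mul_sub, abs_mul, abs_of_pos (inv_pos.2 hJ0)]
    gcongr
    refine (abs_pfun_sub_pfun_le (hf.1 s hs) (hf.1 t ht) (hf₀.1 s hs) (hf₀.1 t ht)).trans ?_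
    linarith [hVle s hs t ht hst, hVle₀ s hs t ht hst]

end Densities

theorem exists_pow_two_le_rpow {n : ℕ} (hn : 1 ≤ n) :
    ∃ K : ℕ, n ≤ 8 ^ K ∧ (2 : ℝ) ^ K ≤ 2 * (n : ℝ) ^ ((1 : ℝ) / 3) := by
  obtain ⟨m, hm, hm'⟩ := exists_nat_pow_near hn (show 1 < 8 by norm_num)
  refine ⟨m + 1, hm'.le, ?_⟩
  have h : (2 : ℝ) ^ m ≤ (n : ℝ) ^ ((1 : ℝ) / 3) := by
    have h8 : ((2 : ℝ) ^ m) ^ 3 ≤ n := by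
      rw [← pow_mul, mul_comm, pow_mul]
      norm_num
      exact_mod_cast hm
    rw [one_div]
    exact (Real.le_rpow_inv_iff_of_pos (by positivity) (by positivity) (by norm_num)).2
      (by exact_mod_cast h8)
  rw [pow_succ]
  linarith

/-- On the event that all cell deviations are controlled, the normalized empirical process is
bounded uniformly over the class. -/
theorem rpow_mul_abs_empProc_div_le {Ω : Type*} {a b : ℝ} {f₀ f : ℝ → ℝ} (hab : a < b)
    (hf₀ : InF a b f₀)
    [IsProbabilityMeasure (densityMeasure a b f₀)] {q Q : ℝ} (hq0 : 0 < q) (hQ0 : 0 < Q)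
    (hqQ : ∀ t ∈ Icc a b, q ≤ f₀ t ∧ f₀ t ≤ Q) {n K : ℕ} (hn1 : 1 ≤ n) (hn : n ≤ 8 ^ K)
    (hK : (2 : ℝ) ^ K ≤ 2 * (n : ℝ) ^ ((1 : ℝ) / 3)) {X : ℕ → Ω → ℝ} {ω : Ω}
    (hx : ∀ i < n, X i ω ∈ Ico a b) {τ : ℝ} (hτ : 0 ≤ τ)
    (hE : ∀ k ≤ K, ∑ j ∈ Finset.range (2 ^ (K + k)),
      Real.exp (cellScale K k *
        |cellDev a b (densityMeasure a b f₀) n (fun i => X i ω) (K + k) j|)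
        ≤ 2 ^ (K + k) * 2 ^ k * Real.exp τ)
    (hf : InF a b f) (hh : hell a b f f₀ ≤ (n : ℝ) ^ (-(1 : ℝ) / 3) * Jfun a b f₀ f) {H : ℝ}
    (hH : H = 1 + 8 / (q * (b - a))) :
    (n : ℝ) ^ ((2 : ℝ) / 3) * |empProc a b f₀ n X (pfun f₀ f) ω| / Jfun a b f₀ f
      ≤ 2 * (100 * H * (4 * H + 5 + τ) + 2 * (Q * (b - a))) := by
  have hba := sub_pos.2 hab
  have hH0 : 0 < H := by rw [hH]; positivity
  have hJ0 : 0 < Jfun a b f₀ f := one_pos.trans_le (one_le_Jfun a b f₀ f)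
  have hn0 : (0 : ℝ) < n := by exact_mod_cast hn1
  set ν := (n : ℝ) ^ ((1 : ℝ) / 3) with hν
  have hν0 : 0 < ν := by positivity
  have hν1 : (n : ℝ) ^ (-(1 : ℝ) / 3) = ν⁻¹ := by rw [hν, neg_div, Real.rpow_neg hn0.le]
  have hν2 : (n : ℝ) ^ ((2 : ℝ) / 3) = ν ^ 2 := by
    rw [hν, ← Real.rpow_natCast, ← Real.rpow_mul hn0.le]; norm_num
  have hν3 : (n : ℝ) = ν ^ 3 := by
    rw [hν, ← Real.rpow_natCast, ← Real.rpow_mul hn0.le]; norm_num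
  have hh' : hell a b f f₀ ≤ 2 / 2 ^ K * Jfun a b f₀ f := by
    refine hh.trans (mul_le_mul_of_nonneg_right ?_ hJ0.le)
    rw [hν1, inv_eq_one_div, div_le_div_iff₀ hν0 (by positivity)]
    linarith
  have h := abs_sum_pfun_sub_integral_le hab hf₀ hq0 hQ0 hqQ hn hx hτ hE hf hh' hH
  have hemp : empProc a b f₀ n X (pfun f₀ f) ω = (1 / (n : ℝ)) *
      (∑ i ∈ Finset.range n, pfun f₀ f (X i ω) - n * ∫ t in Icc a b, pfun f₀ f t * f₀ t) := by
    unfold empProc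
    field_simp
  rw [hemp, abs_mul, abs_of_pos (one_div_pos.2 hn0), hν2, div_le_iff₀ hJ0]
  calc _ ≤ ν ^ 2 * (1 / n * ((100 * H * (4 * H + 5 + τ) + 2 * (Q * (b - a))) * (2 * ν)
          * Jfun a b f₀ f)) := by
        refine mul_le_mul_of_nonneg_left (mul_le_mul_of_nonneg_left (h.trans ?_)
          (by positivity)) (by positivity)
        gcongr
    _ = _ := by rw [hν3]; field_simp

/-- Theorem `InCor`: on the set where
`h(f,f₀) ≤ n^{-1/3} J(f)`, the normalized empirical process
`n^{2/3} |(Pₙ-P)(p_f)| / J(f)` has uniform exponential tails: there are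
constants `c₀, n₀, t₀` with, for all `n ≥ n₀`, `T ≥ t₀`, outer probability
of `{sup ≥ T}` at most `c₀·exp(-T/c₀²)`. -/
theorem stmt_9
    {Ω : Type*} [MeasurableSpace Ω] (ℙ : Measure Ω) [IsProbabilityMeasure ℙ]
    (a b : ℝ) (hab : a < b)
    (f₀ : ℝ → ℝ) (hf₀ : InF a b f₀)
    (X : ℕ → Ω → ℝ) (hXmeas : ∀ i, Measurable (X i))
    (hXlaw : ∀ i, Measure.map (X i) ℙ =
      (MeasureTheory.volume.restrict (Set.Icc a b)).withDensity
        (fun t => ENNReal.ofReal (f₀ t)))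
    (hXindep : ProbabilityTheory.iIndepFun (m := fun _ => Real.measurableSpace) X ℙ) :
    ∃ c₀ > (0 : ℝ), ∃ n₀ : ℕ, ∃ t₀ : ℝ, ∀ n ≥ n₀, ∀ T ≥ t₀,
      ℙ.toOuterMeasure
        {ω | ENNReal.ofReal T ≤
          ⨆ (f : ℝ → ℝ)
            (_ : InF a b f ∧ hell a b f f₀ ≤ (n : ℝ) ^ (-(1 : ℝ)/3) * Jfun a b f₀ f),
            ENNReal.ofReal
              ((n : ℝ) ^ ((2 : ℝ)/3) * |empProc a b f₀ n X (pfun f₀ f) ω| /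
                Jfun a b f₀ f)}
      ≤ ENNReal.ofReal (c₀ * Real.exp (-(T / c₀ ^ 2))) := by
  set μ := densityMeasure a b f₀ with hμ
  have hlaw : ∀ i, ℙ.map (X i) = μ := hXlaw
  have : IsProbabilityMeasure μ :=
    hlaw 0 ▸ Measure.isProbabilityMeasure_map (hXmeas 0).aemeasurable
  obtain ⟨q, hq0, Q, hQ0, hqQ⟩ := hf₀.exists_bounds hab
  have hba := sub_pos.2 hab
  set H := 1 + 8 / (q * (b - a)) with hH
  have hH0 : 0 < H := by positivity
  set Q' := Q * (b - a) with hQ'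
  have hQ'0 : 0 < Q' := by positivity
  set C := 200 * H * (4 * H + 5) + 4 * Q' with hC
  have hC0 : 0 < C := by positivity
  have hCH : 200 * H ≤ C := by nlinarith
  set c := 4 * Real.exp Q' + 2 * C with hc
  have hexp : 1 ≤ Real.exp Q' := Real.one_le_exp hQ'0.le
  have hc0 : 0 < c := by positivity
  refine ⟨c, hc0, 1, 2 * C + 1, fun n hn T hT => ?_⟩
  obtain ⟨K, hK, hK'⟩ := exists_pow_two_le_rpow hn
  set τ := T / (2 * C) with hτ
  have hT0 : 0 < T := by linarith
  have hτ0 : 0 ≤ τ := by positivity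
  have hCτ : C * τ = T / 2 := by rw [hτ]; field_simp
  have hbad := measureReal_exists_le_sum_exp_le (a := a) (b := b) (Q := Q') hXmeas hlaw hXindep
    (fun l j _ => densityMeasure_cell_le hab hQ0.le fun t ht => (hqQ t ht).2) hK τ
  set B := ⋃ k ∈ Finset.range (K + 1), {ω | 2 ^ (K + k) * 2 ^ k * Real.exp τ ≤
    ∑ j ∈ Finset.range (2 ^ (K + k)),
      Real.exp (cellScale K k * |cellDev a b μ n (fun i => X i ω) (K + k) j|)} with hB
  have hae : ∀ᵐ ω ∂ℙ, ∀ i, X i ω ∈ Ico a b := ae_all_iff.2 fun i =>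
    ae_of_ae_map (hXmeas i).aemeasurable (hlaw i ▸ ae_densityMeasure_mem_Ico a b f₀)
  rw [Measure.toOuterMeasure_apply]
  calc _ ≤ ℙ B := ?_
    _ = ENNReal.ofReal (ℙ.real B) := (ofReal_measureReal (measure_ne_top ℙ B)).symm
    _ ≤ _ := ?_
  · refine measure_mono_ae ?_
    filter_upwards [hae] with ω hω hsup
    by_contra hωB
    refine absurd hsup (not_le.2 ?_)
    refine (iSup₂_le (a := ENNReal.ofReal (C + T / 2)) fun f hf =>
      ENNReal.ofReal_le_ofReal ?_).trans_lt
      ((ENNReal.ofReal_lt_ofReal_iff hT0).2 (by linarith))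
    refine (rpow_mul_abs_empProc_div_le hab hf₀ hq0 hQ0 hqQ hn hK hK' (fun i _ => hω i) hτ0
      (fun k hk => ?_) hf.1 hf.2 hH).trans ?_
    · by_contra hlt
      exact hωB (mem_iUnion₂.2 ⟨k, Finset.mem_range_succ_iff.2 hk, (not_le.1 hlt).le⟩)
    · nlinarith
  · refine ENNReal.ofReal_le_ofReal (hbad.trans ?_)
    have : T / c ^ 2 ≤ τ := by
      rw [hτ]
      gcongr
      nlinarith
    gcongr
    linarith
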